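/- arXiv:1911.01942 — 2 statements merged into one kernel-verified Lean document; each statement's English description precedes it below -/
import Mathlib

section
/- Let X be a real Banach space, a < b real numbers, and u, u' : ℝ → X functions such that u' is Bochner integrable on [a,b], ‖u'(·)‖² is integrable on [a,b], and u(t) = u(a) + ∫_a^t u'(s) ds for all t ∈ [a,b]. Then for every t ∈ [a,b], ‖u(t) − Iu(t)‖² ≤ (b−a)·∫_a^b ‖u'(s)‖² ds, where Iu is the linear interpolant of u on [a,b]. -/
open MeasureTheory intervalIntegral

/-- Cauchy–Schwarz inequality against the constant function on an interval. -/
theorem sq_intervalIntegral_le_mul_intervalIntegral_sq {a b : ℝ} (hab : a ≤ b) {f : ℝ → ℝ}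
    (hf : IntervalIntegrable f volume a b)
    (hf2 : IntervalIntegrable (fun s => f s ^ 2) volume a b) :
    (∫ s in a..b, f s) ^ 2 ≤ (b - a) * ∫ s in a..b, f s ^ 2 := by
  rcases hab.eq_or_lt with rfl | hlt
  · simp
  have hba : 0 < b - a := sub_pos.2 hlt
  set c : ℝ := (∫ s in a..b, f s) / (b - a) with hc
  have hI : ∫ s in a..b, f s = c * (b - a) := by
    rw [hc, div_mul_cancel₀ _ hba.ne']
  have hnonneg : 0 ≤ ∫ s in a..b, (f s - c) ^ 2 :=
    integral_nonneg hab fun s _ => sq_nonneg _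
  have hexpand : ∫ s in a..b, (f s - c) ^ 2 =
      (∫ s in a..b, f s ^ 2) - 2 * c * (∫ s in a..b, f s) + (b - a) * c ^ 2 := by
    have hsplit : ∀ s, (f s - c) ^ 2 = f s ^ 2 - 2 * c * f s + c ^ 2 := fun s => by ring
    simp_rw [hsplit]
    rw [integral_add (hf2.sub (hf.const_mul _)) intervalIntegrable_const,
      integral_sub hf2 (hf.const_mul _), intervalIntegral.integral_const_mul,
      intervalIntegral.integral_const, smul_eq_mul]
  rw [hexpand, hI] at hnonneg
  rw [hI]
  nlinarith [mul_nonneg hba.le hnonneg]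

/-- Pointwise bound from the proof of Lemma 4.1 (thm:tp:lagrange):
`‖u t − Iu t‖² ≤ (b−a)·∫_a^b ‖u'‖²` for the linear interpolant
`Iu t = ((b−t)•u a + (t−a)•u b)/(b−a)`. -/
theorem linear_interpolant_pointwise_bound
    {X : Type*} [NormedAddCommGroup X] [NormedSpace ℝ X] [CompleteSpace X]
    (a b : ℝ) (hab : a < b) (u u' : ℝ → X)
    (hint : IntervalIntegrable u' volume a b)
    (hint2 : IntervalIntegrable (fun s => ‖u' s‖ ^ 2) volume a b)
    (hu : ∀ t ∈ Set.Icc a b, u t = u a + ∫ s in a..t, u' s) :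
    ∀ t ∈ Set.Icc a b,
      ‖u t - (b - a)⁻¹ • ((b - t) • u a + (t - a) • u b)‖ ^ 2 ≤
        (b - a) * ∫ s in a..b, ‖u' s‖ ^ 2 := by
  intro t ht
  have hba : 0 < b - a := sub_pos.2 hab
  have htI : t ∈ Set.uIcc a b := by rwa [Set.uIcc_of_le hab.le]
  have hat : IntervalIntegrable u' volume a t :=
    hint.mono_set (Set.uIcc_subset_uIcc_left htI)
  have htb : IntervalIntegrable u' volume t b :=
    hint.mono_set (Set.uIcc_subset_uIcc_right htI)
  have herr : u t - (b - a)⁻¹ • ((b - t) • u a + (t - a) • u b) =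
      (b - a)⁻¹ • ((b - t) • (∫ s in a..t, u' s) - (t - a) • ∫ s in t..b, u' s) := by
    rw [hu t ht, hu b (Set.right_mem_Icc.2 hab.le), ← integral_add_adjacent_intervals hat htb]
    match_scalars <;> field_simp <;> ring
  have hnorm : ‖u t - (b - a)⁻¹ • ((b - t) • u a + (t - a) • u b)‖ ≤
      ∫ s in a..b, ‖u' s‖ := by
    rw [herr, norm_smul, norm_inv, Real.norm_of_nonneg hba.le, inv_mul_le_iff₀ hba,
      ← integral_add_adjacent_intervals hat.norm htb.norm]
    refine (norm_sub_le _ _).trans ?_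
    rw [norm_smul, norm_smul, Real.norm_of_nonneg (sub_nonneg.2 ht.2),
      Real.norm_of_nonneg (sub_nonneg.2 ht.1), mul_add]
    gcongr
    · exact ht.1
    · exact intervalIntegral.norm_integral_le_integral_norm ht.1
    · exact ht.2
    · exact intervalIntegral.norm_integral_le_integral_norm ht.2
  calc _ ≤ (∫ s in a..b, ‖u' s‖) ^ 2 := by gcongr
    _ ≤ _ := sq_intervalIntegral_le_mul_intervalIntegral_sq hab.le hint.norm hint2
end

section
/- Let X be a real Banach space, a < b real numbers, and u, u', u'' : ℝ → X functions such that u' and u'' are Bochner integrable on [a,b], ‖u''(·)‖² is integrable on [a,b], u(t) = u(a) + ∫_a^t u'(s) ds and u'(t) = u'(a) + ∫_a^t u''(s) ds for all t ∈ [a,b]. Then ∫_a^b ‖u'(t) − (u(b) − u(a))/(b−a)‖² dt ≤ (b−a)²·∫_a^b ‖u''(r)‖² dr. -/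
open MeasureTheory intervalIntegral

/-- Cauchy–Schwarz against the constant function `1` on an interval. -/
theorem sq_intervalIntegral_le {f : ℝ → ℝ} {a b : ℝ} (hab : a < b)
    (hf : IntervalIntegrable f volume a b)
    (hf2 : IntervalIntegrable (fun r => f r ^ 2) volume a b) :
    (∫ r in a..b, f r) ^ 2 ≤ (b - a) * ∫ r in a..b, f r ^ 2 := by
  have hba : 0 < b - a := sub_pos.mpr hab
  set m := (b - a)⁻¹ * ∫ r in a..b, f r with hm
  have hL : ∫ r in a..b, f r = (b - a) * m := by rw [hm]; field_simp
  have h0 : 0 ≤ ∫ r in a..b, (f r - m) ^ 2 :=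
    integral_nonneg hab.le fun r _ => sq_nonneg _
  have hexp : ∫ r in a..b, (f r - m) ^ 2 =
      (∫ r in a..b, f r ^ 2) - 2 * m * (∫ r in a..b, f r) + (b - a) * m ^ 2 := by
    have : (fun r => (f r - m) ^ 2) = fun r => f r ^ 2 - 2 * m * f r + m ^ 2 := by
      funext r; ring
    rw [this, integral_add (hf2.sub (hf.const_mul _)) intervalIntegrable_const,
      integral_sub hf2 (hf.const_mul _), intervalIntegral.integral_const_mul,
      intervalIntegral.integral_const, smul_eq_mul]
  rw [hexp, hL] at h0
  rw [hL]
  nlinarith [mul_nonneg hba.le h0]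

/-- A uniform bound on the distance from a vector to the values of `f` on `[a, b]` also bounds
its distance to the mean of `f` over `[a, b]`. -/
theorem norm_sub_inv_smul_intervalIntegral_le {X : Type*} [NormedAddCommGroup X]
    [NormedSpace ℝ X] [CompleteSpace X] {f : ℝ → X} {a b C : ℝ} (hab : a < b)
    (hf : IntervalIntegrable f volume a b) (x : X)
    (hC : ∀ s ∈ Set.Icc a b, ‖x - f s‖ ≤ C) :
    ‖x - (b - a)⁻¹ • ∫ s in a..b, f s‖ ≤ C := by
  have hba : 0 < b - a := sub_pos.mpr hab
  have heq : x - (b - a)⁻¹ • ∫ s in a..b, f s = (b - a)⁻¹ • ∫ s in a..b, (x - f s) := by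
    rw [integral_sub intervalIntegrable_const hf, intervalIntegral.integral_const, smul_sub,
      inv_smul_smul₀ hba.ne']
  have hle : ‖∫ s in a..b, (x - f s)‖ ≤ C * |b - a| :=
    norm_integral_le_of_norm_le_const fun s hs =>
      hC s (Set.Ioc_subset_Icc_self (Set.uIoc_of_le hab.le ▸ hs))
  rw [abs_of_pos hba] at hle
  rw [heq, norm_smul, norm_inv, Real.norm_of_nonneg hba.le, inv_mul_le_iff₀ hba, mul_comm]
  exact hle

/-- Differences of values of a primitive on `[a, b]` are bounded by the integral of the norm. -/
theorem norm_primitive_sub_primitive_le {X : Type*} [NormedAddCommGroup X] [NormedSpace ℝ X]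
    {g : ℝ → X} {a b s t : ℝ} (hg : IntervalIntegrable g volume a b)
    (hs : s ∈ Set.Icc a b) (ht : t ∈ Set.Icc a b) :
    ‖(∫ r in a..t, g r) - ∫ r in a..s, g r‖ ≤ ∫ r in a..b, ‖g r‖ := by
  have hab : a ≤ b := hs.1.trans hs.2
  have hsub : ∀ {c}, c ∈ Set.Icc a b → IntervalIntegrable g volume a c := fun hc =>
    hg.mono_set (by
      rw [Set.uIcc_of_le hc.1, Set.uIcc_of_le hab]
      exact Set.Icc_subset_Icc_right hc.2)
  rw [integral_interval_sub_left (hsub ht) (hsub hs), integral_of_le hab]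
  refine norm_integral_le_integral_norm_uIoc.trans ?_
  refine setIntegral_mono_set ((intervalIntegrable_iff_integrableOn_Ioc_of_le hab).1 hg.norm)
    (Filter.Eventually.of_forall fun _ => norm_nonneg _) (LE.le.eventuallyLE ?_)
  exact Set.Ioc_subset_Ioc (le_min hs.1 ht.1) (max_le hs.2 ht.2)

/-- Single-interval form of the second estimate of Lemma 4.1 (thm:tp:lagrange):
`∫_a^b ‖u' − (u b − u a)/(b−a)‖² ≤ (b−a)²·∫_a^b ‖u''‖²`. -/
theorem linear_interpolant_derivative_L2_bound
    {X : Type*} [NormedAddCommGroup X] [NormedSpace ℝ X] [CompleteSpace X]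
    (a b : ℝ) (hab : a < b) (u u' u'' : ℝ → X)
    (hint1 : IntervalIntegrable u' volume a b)
    (hint2 : IntervalIntegrable u'' volume a b)
    (hint3 : IntervalIntegrable (fun r => ‖u'' r‖ ^ 2) volume a b)
    (hu : ∀ t ∈ Set.Icc a b, u t = u a + ∫ s in a..t, u' s)
    (hu' : ∀ t ∈ Set.Icc a b, u' t = u' a + ∫ s in a..t, u'' s) :
    (∫ t in a..b, ‖u' t - (b - a)⁻¹ • (u b - u a)‖ ^ 2) ≤
      (b - a) ^ 2 * ∫ r in a..b, ‖u'' r‖ ^ 2 := by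
  have hba : 0 < b - a := sub_pos.mpr hab
  have hmean : u b - u a = ∫ s in a..b, u' s := by
    rw [hu b (Set.right_mem_Icc.mpr hab.le), add_sub_cancel_left]
  have hpt : ∀ t ∈ Set.Icc a b,
      ‖u' t - (b - a)⁻¹ • (u b - u a)‖ ≤ ∫ r in a..b, ‖u'' r‖ := by
    intro t ht
    rw [hmean]
    refine norm_sub_inv_smul_intervalIntegral_le hab hint1 _ fun s hs => ?_
    rw [hu' t ht, hu' s hs, add_sub_add_left_eq_sub]
    exact norm_primitive_sub_primitive_le hint2 hs ht
  have hbound : (∫ t in a..b, ‖u' t - (b - a)⁻¹ • (u b - u a)‖ ^ 2) ≤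
      (∫ r in a..b, ‖u'' r‖) ^ 2 * |b - a| := by
    refine (Real.le_norm_self _).trans (norm_integral_le_of_norm_le_const fun t ht => ?_)
    rw [norm_pow, norm_norm]
    gcongr
    exact hpt t (Set.Ioc_subset_Icc_self (Set.uIoc_of_le hab.le ▸ ht))
  rw [abs_of_pos hba] at hbound
  calc _ ≤ _ := hbound
    _ ≤ ((b - a) * ∫ r in a..b, ‖u'' r‖ ^ 2) * (b - a) := by
      gcongr
      exact sq_intervalIntegral_le hab hint2.norm hint3
    _ = _ := by ring
end
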